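/- arXiv:1401.2609 — 3 statements merged into one kernel-verified Lean document; each statement's English description precedes it below -/
import Mathlib

section
/- Let c* = (1/(2π²))·∫_ℝ ((1 − e^{−2π²y²})/y²)² dy, a finite positive constant. Then for every a : ℤ → ℂ with Σ_{k∈ℤ} k²|a(k)|² < ∞, one has lim_{t→0⁺} t^{−3/2} · Σ_{(k,m)∈ℤ²∖{(0,0)}} ((k+m)²·|a(k+m)|²/(4π²(k²+m²)²)) · (1 − e^{−4π²(k²+m²)t})² = c* · Σ_{k∈ℤ} k²|a(k)|². -/
open Real Filter

/-- The profile `((1 - e^{-cs}) / s)²`. -/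
noncomputable def heatProfile (c s : ℝ) : ℝ := ((1 - Real.exp (-c * s)) / s) ^ 2

lemma heatProfile_nonneg (c s : ℝ) : 0 ≤ heatProfile c s := sq_nonneg _

lemma measurable_heatProfile (c : ℝ) : Measurable (heatProfile c) := by
  unfold heatProfile
  fun_prop

lemma continuousAt_heatProfile (c : ℝ) {s : ℝ} (hs : s ≠ 0) :
    ContinuousAt (heatProfile c) s := by
  unfold heatProfile
  fun_prop (disch := assumption)

lemma heatProfile_le {c s : ℝ} (hc : 0 ≤ c) (hs : 0 ≤ s) :
    heatProfile c s ≤ (c ^ 2 + c) * (1 + s)⁻¹ := by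
  rw [← div_eq_mul_inv, le_div_iff₀ (by positivity)]
  unfold heatProfile
  rcases hs.eq_or_lt with rfl | hs
  · simp; positivity
  set w := (1 - Real.exp (-c * s)) / s with hw
  have hws : w * s = 1 - Real.exp (-c * s) := div_mul_cancel₀ _ hs.ne'
  have h1 : w * s ≤ 1 := by rw [hws]; linarith [Real.exp_pos (-c * s)]
  have hwc : w ≤ c := by
    rw [hw, div_le_iff₀ hs]
    linarith [Real.add_one_le_exp (-c * s)]
  have hw0 : 0 ≤ w := by
    refine div_nonneg ?_ hs.le
    rw [sub_nonneg, Real.exp_le_one_iff]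
    nlinarith [mul_nonneg hc hs.le]
  nlinarith [mul_nonneg hw0 hs.le, mul_le_mul_of_nonneg_left h1 hw0, pow_le_pow_left₀ hw0 hwc 2]

/-- The integral of a function of the integer part is the sum over the integers. -/
lemma hasSum_integral_comp_floor {g : ℤ → ℝ}
    (hg : MeasureTheory.Integrable (fun x : ℝ => g ⌊x⌋)) :
    HasSum g (∫ x : ℝ, g ⌊x⌋) := by
  have h := MeasureTheory.hasSum_integral_iUnion (μ := MeasureTheory.volume)
    (s := fun n : ℤ => Set.Ico (n : ℝ) (n + 1)) (f := fun x : ℝ => g ⌊x⌋)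
    (fun _ => measurableSet_Ico) (Set.pairwise_disjoint_Ico_intCast ℝ) hg.integrableOn
  rw [iUnion_Ico_intCast, MeasureTheory.setIntegral_univ] at h
  have e : ∀ n : ℤ, ∫ x in Set.Ico (n : ℝ) (n + 1), g ⌊x⌋ = g n := fun n => by
    rw [MeasureTheory.setIntegral_congr_fun measurableSet_Ico (g := fun _ => g n)
      fun x hx => by simp only [Int.floor_eq_on_Ico n x hx]]
    simp
  simpa only [e] using h

/-- Rescaled version of `hasSum_integral_comp_floor`. -/
lemma hasSum_integral_comp_floor_div {g : ℤ → ℝ} {h : ℝ} (hh : 0 < h)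
    (hg : MeasureTheory.Integrable (fun x : ℝ => g ⌊x / h⌋)) :
    HasSum (fun k => h * g k) (∫ x : ℝ, g ⌊x / h⌋) := by
  have hg' : MeasureTheory.Integrable (fun x : ℝ => g ⌊x⌋) := by
    have := hg.comp_mul_right' hh.ne'
    simpa [mul_div_cancel_right₀ _ hh.ne'] using this
  have e := MeasureTheory.Measure.integral_comp_div (fun x : ℝ => g ⌊x⌋) h
  rw [abs_of_pos hh, smul_eq_mul] at e
  rw [e]
  exact (hasSum_integral_comp_floor hg').mul_left h

lemma mul_floor_div_mem_Icc {h : ℝ} (hh : 0 < h) (x : ℝ) :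
    h * ⌊x / h⌋ ∈ Set.Icc (x - h) x := by
  have h1 := Int.floor_le (x / h)
  have h2 := (Int.lt_floor_add_one (x / h)).le
  rw [le_div_iff₀ hh] at h1
  rw [div_le_iff₀ hh] at h2
  constructor <;> linarith

lemma heatProfile_floor_le {c t : ℝ} (hc : 0 ≤ c) (ht : 0 < t) (ht1 : t ≤ 1) (j : ℤ) (x : ℝ) :
    heatProfile c (t * ((⌊x / √t⌋ : ℝ) ^ 2 + ((j : ℝ) - ⌊x / √t⌋) ^ 2)) ≤
      3 * (c ^ 2 + c) * (1 + x ^ 2)⁻¹ := by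
  refine (heatProfile_le hc (by positivity)).trans ?_
  obtain ⟨h1, h2⟩ := mul_floor_div_mem_Icc (Real.sqrt_pos.2 ht) x
  set k : ℝ := (⌊x / √t⌋ : ℝ)
  have hs1 : √t ≤ 1 := Real.sqrt_le_iff.2 ⟨zero_le_one, by simpa using ht1⟩
  have e : (√t * k) ^ 2 = t * k ^ 2 := by rw [mul_pow, Real.sq_sqrt ht.le]
  have hj : 0 ≤ t * (j - k) ^ 2 := by positivity
  have key : 1 + x ^ 2 ≤ 3 * (1 + t * (k ^ 2 + (j - k) ^ 2)) := by
    have : (x - √t * k) ^ 2 ≤ 1 := by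
      rw [sq_le_one_iff_abs_le_one, abs_le]
      constructor <;> linarith
    nlinarith [sq_nonneg (x - 2 * (√t * k))]
  have hinv : (1 + t * (k ^ 2 + (j - k) ^ 2))⁻¹ ≤ 3 * (1 + x ^ 2)⁻¹ := by
    rw [← div_eq_mul_inv, le_div_iff₀ (by positivity), inv_mul_le_iff₀ (by positivity)]
    linarith
  calc (c ^ 2 + c) * (1 + t * (k ^ 2 + (j - k) ^ 2))⁻¹
      ≤ (c ^ 2 + c) * (3 * (1 + x ^ 2)⁻¹) := by gcongr
    _ = _ := by ring

lemma measurable_heatProfile_floor (c t : ℝ) (j : ℤ) :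
    Measurable fun x : ℝ =>
      heatProfile c (t * ((⌊x / √t⌋ : ℝ) ^ 2 + ((j : ℝ) - ⌊x / √t⌋) ^ 2)) :=
  (measurable_from_top (f := fun k : ℤ =>
    heatProfile c (t * ((k : ℝ) ^ 2 + ((j : ℝ) - k) ^ 2)))).comp
      (Int.measurable_floor.comp (measurable_id.div_const _))

lemma integrable_heatProfile_floor {c t : ℝ} (hc : 0 ≤ c) (ht : 0 < t) (ht1 : t ≤ 1) (j : ℤ) :
    MeasureTheory.Integrable fun x : ℝ =>
      heatProfile c (t * ((⌊x / √t⌋ : ℝ) ^ 2 + ((j : ℝ) - ⌊x / √t⌋) ^ 2)) := by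
  refine (integrable_inv_one_add_sq.const_mul (3 * (c ^ 2 + c))).mono'
    (measurable_heatProfile_floor c t j).aestronglyMeasurable (.of_forall fun x => ?_)
  rw [Real.norm_of_nonneg (heatProfile_nonneg _ _)]
  exact heatProfile_floor_le hc ht ht1 j x

lemma hasSum_heatProfile {c t : ℝ} (hc : 0 ≤ c) (ht : 0 < t) (ht1 : t ≤ 1) (j : ℤ) :
    HasSum (fun k : ℤ => √t * heatProfile c (t * ((k : ℝ) ^ 2 + ((j : ℝ) - k) ^ 2)))
      (∫ x : ℝ, heatProfile c (t * ((⌊x / √t⌋ : ℝ) ^ 2 + ((j : ℝ) - ⌊x / √t⌋) ^ 2))) :=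
  hasSum_integral_comp_floor_div
    (g := fun k : ℤ => heatProfile c (t * ((k : ℝ) ^ 2 + ((j : ℝ) - k) ^ 2)))
    (Real.sqrt_pos.2 ht) (integrable_heatProfile_floor hc ht ht1 j)

lemma integral_heatProfile_floor_le {c t : ℝ} (hc : 0 ≤ c) (ht : 0 < t) (ht1 : t ≤ 1) (j : ℤ) :
    ∫ x : ℝ, heatProfile c (t * ((⌊x / √t⌋ : ℝ) ^ 2 + ((j : ℝ) - ⌊x / √t⌋) ^ 2)) ≤
      ∫ x : ℝ, 3 * (c ^ 2 + c) * (1 + x ^ 2)⁻¹ :=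
  MeasureTheory.integral_mono (integrable_heatProfile_floor hc ht ht1 j)
    (integrable_inv_one_add_sq.const_mul _) (heatProfile_floor_le hc ht ht1 j)

lemma eventually_pos_and_le_one : ∀ᶠ t : ℝ in nhdsWithin 0 (Set.Ioi 0), 0 < t ∧ t ≤ 1 := by
  filter_upwards [Ioc_mem_nhdsGT (zero_lt_one (α := ℝ))] with t ht using ht

lemma tendsto_sqrt_mul_floor_div (x : ℝ) :
    Tendsto (fun t : ℝ => √t * ⌊x / √t⌋) (nhdsWithin 0 (Set.Ioi 0)) (nhds x) := by
  have h0 : Tendsto (fun t : ℝ => √t) (nhdsWithin 0 (Set.Ioi 0)) (nhds 0) := by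
    simpa using (Real.continuous_sqrt.tendsto 0).mono_left nhdsWithin_le_nhds
  refine tendsto_of_tendsto_of_tendsto_of_le_of_le' (by simpa using h0.const_sub x)
    tendsto_const_nhds ?_ ?_ <;>
  · filter_upwards [eventually_pos_and_le_one] with t ht
    have := mul_floor_div_mem_Icc (Real.sqrt_pos.2 ht.1) x
    first | exact this.1 | exact this.2

lemma tendsto_integral_heatProfile_floor {c : ℝ} (hc : 0 ≤ c) (j : ℤ) :
    Tendsto (fun t : ℝ => ∫ x : ℝ,
        heatProfile c (t * ((⌊x / √t⌋ : ℝ) ^ 2 + ((j : ℝ) - ⌊x / √t⌋) ^ 2)))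
      (nhdsWithin 0 (Set.Ioi 0)) (nhds (∫ x : ℝ, heatProfile c (2 * x ^ 2))) := by
  refine MeasureTheory.tendsto_integral_filter_of_dominated_convergence
    (fun x => 3 * (c ^ 2 + c) * (1 + x ^ 2)⁻¹)
    (.of_forall fun t => (measurable_heatProfile_floor c t j).aestronglyMeasurable) ?_
    (integrable_inv_one_add_sq.const_mul _) ?_
  · filter_upwards [eventually_pos_and_le_one] with t ht
    refine .of_forall fun x => ?_
    rw [Real.norm_of_nonneg (heatProfile_nonneg _ _)]
    exact heatProfile_floor_le hc ht.1 ht.2 j x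
  · filter_upwards [MeasureTheory.Measure.ae_ne MeasureTheory.volume (0 : ℝ)] with x hx
    refine (continuousAt_heatProfile c (s := 2 * x ^ 2) (by positivity)).tendsto.comp ?_
    have h0 : Tendsto (fun t : ℝ => √t) (nhdsWithin 0 (Set.Ioi 0)) (nhds 0) := by
      simpa using (Real.continuous_sqrt.tendsto 0).mono_left nhdsWithin_le_nhds
    have hu := tendsto_sqrt_mul_floor_div x
    have := (hu.pow 2).add (((h0.mul_const (j : ℝ)).sub hu).pow 2)
    rw [show x ^ 2 + (0 * (j : ℝ) - x) ^ 2 = 2 * x ^ 2 by ring] at this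
    refine this.congr' ?_
    filter_upwards [eventually_pos_and_le_one] with t ht
    have e := Real.sq_sqrt ht.1.le
    linear_combination ((⌊x / √t⌋ : ℝ) ^ 2 + ((j : ℝ) - ⌊x / √t⌋) ^ 2) * e

lemma integral_heatProfile_two_mul_sq :
    ∫ x : ℝ, heatProfile (4 * π ^ 2) (2 * x ^ 2) =
      2 * ∫ y : ℝ, heatProfile (2 * π ^ 2) (y ^ 2) := by
  have e := MeasureTheory.Measure.integral_comp_div
    (fun x : ℝ => heatProfile (4 * π ^ 2) (2 * x ^ 2)) 2
  have e2 : ∀ y : ℝ, heatProfile (4 * π ^ 2) (2 * (y / 2) ^ 2) =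
      4 * heatProfile (2 * π ^ 2) (y ^ 2) := by
    intro y
    unfold heatProfile
    rw [show -(4 * π ^ 2) * (2 * (y / 2) ^ 2) = -(2 * π ^ 2) * y ^ 2 by ring]
    rcases eq_or_ne y 0 with rfl | hy
    · simp
    · field_simp
      ring
  simp only [e2, MeasureTheory.integral_const_mul, abs_two, smul_eq_mul] at e
  linarith

lemma integral_heatProfile_sq_pos {c : ℝ} (hc : 0 < c) :
    0 < ∫ y : ℝ, heatProfile c (y ^ 2) := by
  have hi : MeasureTheory.Integrable fun y : ℝ => heatProfile c (y ^ 2) := by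
    refine (integrable_inv_one_add_sq.const_mul (c ^ 2 + c)).mono'
      ((measurable_heatProfile c).comp (measurable_id.pow_const 2)).aestronglyMeasurable
      (.of_forall fun x => ?_)
    rw [Real.norm_of_nonneg (heatProfile_nonneg _ _)]
    exact heatProfile_le hc.le (sq_nonneg x)
  rw [MeasureTheory.integral_pos_iff_support_of_nonneg (fun y => heatProfile_nonneg _ _) hi]
  refine lt_of_lt_of_le ?_ (MeasureTheory.measure_mono (s := Set.Ioi (0 : ℝ)) fun y hy => ?_)
  · simp
  · have hy : 0 < y := hy
    have : Real.exp (-c * y ^ 2) < 1 := by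
      rw [Real.exp_lt_one_iff]
      nlinarith [mul_pos hc (pow_pos hy 2)]
    refine pow_ne_zero 2 (div_ne_zero ?_ (by positivity))
    linarith

/-- Coordinates `(j, k) ↦ (k, j - k)`, whose inverse sends `(k, m)` to `(k + m, k)`. -/
def intSumEquiv : ℤ × ℤ ≃ ℤ × ℤ where
  toFun q := (q.2, q.1 - q.2)
  invFun p := (p.1 + p.2, p.1)
  left_inv q := by ext <;> simp
  right_inv p := by ext <;> simp

lemma tsum_ne_zero_eq_tsum_integral (b : ℤ → ℝ) (hb : ∀ j, 0 ≤ b j) (hs : Summable b)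
    {t : ℝ} (ht : 0 < t) (ht1 : t ≤ 1) :
    (∑' p : {p : ℤ × ℤ // p ≠ 0},
        b (p.1.1 + p.1.2) / (4 * π ^ 2 * ((p.1.1 : ℝ) ^ 2 + (p.1.2 : ℝ) ^ 2) ^ 2)
          * (1 - Real.exp (-4 * π ^ 2 * ((p.1.1 : ℝ) ^ 2 + (p.1.2 : ℝ) ^ 2) * t)) ^ 2)
        / t ^ ((3 : ℝ) / 2) =
      ∑' j : ℤ, b j / (4 * π ^ 2) * ∫ x : ℝ,
        heatProfile (4 * π ^ 2) (t * ((⌊x / √t⌋ : ℝ) ^ 2 + ((j : ℝ) - ⌊x / √t⌋) ^ 2)) := by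
  set F : ℤ × ℤ → ℝ := fun p =>
    b (p.1 + p.2) / (4 * π ^ 2 * ((p.1 : ℝ) ^ 2 + (p.2 : ℝ) ^ 2) ^ 2)
      * (1 - Real.exp (-4 * π ^ 2 * ((p.1 : ℝ) ^ 2 + (p.2 : ℝ) ^ 2) * t)) ^ 2 with hF
  have hc : 0 ≤ 4 * π ^ 2 := by positivity
  have h1 : ∑' p : {p : ℤ × ℤ // p ≠ 0}, F p.1 = ∑' p, F p :=
    tsum_subtype_eq_of_support_subset (s := {p : ℤ × ℤ | p ≠ 0}) fun p hp h0 => hp (by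
      simp [hF, h0])
  have hpow : t ^ ((3 : ℝ) / 2) = t * √t := by
    rw [show (3 : ℝ) / 2 = 1 + 1 / 2 by norm_num, Real.rpow_add ht, Real.rpow_one,
      Real.sqrt_eq_rpow]
  set G : ℤ × ℤ → ℝ := fun q => b q.1 / (4 * π ^ 2) *
    (√t * heatProfile (4 * π ^ 2) (t * ((q.2 : ℝ) ^ 2 + ((q.1 : ℝ) - q.2) ^ 2))) with hG
  have hFG : ∀ q, F (intSumEquiv q) / t ^ ((3 : ℝ) / 2) = G q := by
    rintro ⟨j, k⟩
    have hst : 0 < √t := Real.sqrt_pos.2 ht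
    rw [hpow]
    simp only [hF, hG, intSumEquiv, Equiv.coe_fn_mk, heatProfile, add_sub_cancel, Int.cast_sub]
    generalize (k : ℝ) ^ 2 + ((j : ℝ) - k) ^ 2 = r
    rw [show -(4 * π ^ 2) * (t * r) = -4 * π ^ 2 * r * t by ring]
    generalize Real.exp (-4 * π ^ 2 * r * t) = E
    rcases eq_or_ne r 0 with rfl | hr
    · simp
    · field_simp
      rw [Real.sq_sqrt ht.le]
  have hG0 : ∀ q, 0 ≤ G q := fun q =>
    mul_nonneg (div_nonneg (hb _) hc) (mul_nonneg (Real.sqrt_nonneg _) (heatProfile_nonneg _ _))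
  have hrow : ∀ j : ℤ, HasSum (fun k => G (j, k)) (b j / (4 * π ^ 2) * ∫ x : ℝ,
      heatProfile (4 * π ^ 2) (t * ((⌊x / √t⌋ : ℝ) ^ 2 + ((j : ℝ) - ⌊x / √t⌋) ^ 2))) :=
    fun j => (hasSum_heatProfile hc ht ht1 j).mul_left _
  have hGs : Summable G := by
    rw [summable_prod_of_nonneg hG0]
    refine ⟨fun j => (hrow j).summable, ?_⟩
    refine .of_nonneg_of_le (fun j => tsum_nonneg fun k => hG0 _) (fun j => ?_)
      ((hs.div_const (4 * π ^ 2)).mul_right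
        (∫ x : ℝ, 3 * ((4 * π ^ 2) ^ 2 + 4 * π ^ 2) * (1 + x ^ 2)⁻¹))
    rw [(hrow j).tsum_eq]
    exact mul_le_mul_of_nonneg_left (integral_heatProfile_floor_le hc ht ht1 j)
      (div_nonneg (hb j) hc)
  calc (∑' p : {p : ℤ × ℤ // p ≠ 0}, F p.1) / t ^ ((3 : ℝ) / 2)
      = ∑' q, F (intSumEquiv q) / t ^ ((3 : ℝ) / 2) := by
        rw [h1, tsum_div_const, intSumEquiv.tsum_eq]
    _ = ∑' q, G q := tsum_congr hFG
    _ = ∑' j, ∑' k, G (j, k) := hGs.tsum_prod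
    _ = _ := tsum_congr fun j => (hrow j).tsum_eq

/-- Fourier-series form of Lemma 4.4: with
`c* = (1/(2π²))·∫_ℝ ((1 − e^{−2π²y²})/y²)² dy`, a finite positive constant, for every
`a : ℤ → ℂ` with `Σ k²|a(k)|² < ∞`,
`t^{−3/2}·Σ_{(k,m)≠(0,0)} ((k+m)²|a(k+m)|²/(4π²(k²+m²)²))·(1 − e^{−4π²(k²+m²)t})²`
converges, as `t → 0⁺`, to `c*·Σ_k k²|a(k)|²`. -/
theorem heat_semigroup_small_time_asymptotics
    (c : ℝ) (hc : c = (1 / (2 * π ^ 2)) * ∫ y : ℝ, ((1 - Real.exp (-2 * π ^ 2 * y ^ 2)) / y ^ 2) ^ 2) :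
    0 < c ∧
    ∀ (a : ℤ → ℂ), Summable (fun k : ℤ => (k : ℝ) ^ 2 * ‖a k‖ ^ 2) →
      Tendsto (fun t : ℝ =>
          (∑' p : {p : ℤ × ℤ // p ≠ 0},
            ((p.1.1 + p.1.2 : ℤ) : ℝ) ^ 2 * ‖a (p.1.1 + p.1.2)‖ ^ 2
                / (4 * π ^ 2 * ((p.1.1 : ℝ) ^ 2 + (p.1.2 : ℝ) ^ 2) ^ 2)
              * (1 - Real.exp (-4 * π ^ 2 * ((p.1.1 : ℝ) ^ 2 + (p.1.2 : ℝ) ^ 2) * t)) ^ 2)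
            / t ^ ((3 : ℝ) / 2))
        (nhdsWithin 0 (Set.Ioi 0))
        (nhds (c * ∑' k : ℤ, (k : ℝ) ^ 2 * ‖a k‖ ^ 2)) := by
  have hc' : c = (1 / (2 * π ^ 2)) * ∫ y : ℝ, heatProfile (2 * π ^ 2) (y ^ 2) := by
    simp only [hc, heatProfile, neg_mul]
  refine ⟨?_, fun a ha => ?_⟩
  · rw [hc']
    exact mul_pos (by positivity) (integral_heatProfile_sq_pos (by positivity))
  set b : ℤ → ℝ := fun k => (k : ℝ) ^ 2 * ‖a k‖ ^ 2 with hbdef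
  have hb : ∀ j, 0 ≤ b j := fun j => by positivity
  have hc4 : 0 ≤ 4 * π ^ 2 := by positivity
  have hlim : c * ∑' k, b k = ∑' j, b j / (4 * π ^ 2) *
      ∫ x : ℝ, heatProfile (4 * π ^ 2) (2 * x ^ 2) := by
    rw [tsum_mul_right, tsum_div_const, hc', integral_heatProfile_two_mul_sq]
    field_simp
    ring
  rw [hlim]
  refine Tendsto.congr' (f₁ := fun t : ℝ => ∑' j : ℤ, b j / (4 * π ^ 2) * ∫ x : ℝ,
    heatProfile (4 * π ^ 2) (t * ((⌊x / √t⌋ : ℝ) ^ 2 + ((j : ℝ) - ⌊x / √t⌋) ^ 2))) ?_ ?_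
  · filter_upwards [eventually_pos_and_le_one] with t ht
    exact (tsum_ne_zero_eq_tsum_integral b hb ha ht.1 ht.2).symm
  · refine tendsto_tsum_of_dominated_convergence ((ha.div_const (4 * π ^ 2)).mul_right
        (∫ x : ℝ, 3 * ((4 * π ^ 2) ^ 2 + 4 * π ^ 2) * (1 + x ^ 2)⁻¹))
      (fun j => (tendsto_integral_heatProfile_floor hc4 j).const_mul _) ?_
    filter_upwards [eventually_pos_and_le_one] with t ht j
    rw [Real.norm_of_nonneg (mul_nonneg (div_nonneg (hb j) hc4)
      (MeasureTheory.integral_nonneg fun _ => heatProfile_nonneg _ _))]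
    exact mul_le_mul_of_nonneg_left (integral_heatProfile_floor_le hc4 ht.1 ht.2 j)
      (div_nonneg (hb j) hc4)
end

section
/- Define g : ℝ² → ℝ by g(x,y) = (1 − e^{−π²(x²+y²)})/(x²+y²) for (x,y) ≠ (0,0) and g(0,0) = π². Then there exists a constant c > 0 such that for all x, y ∈ ℝ: |g(x,y)| ≤ c/(1+y²) and |∂_y g(x,y)| ≤ c/(1+|y|³), the bounds being uniform in x. -/
open Real

/-- The function `g(x,y) = (1 − e^{−π²(x²+y²)})/(x²+y²)` for `(x,y) ≠ (0,0)`,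
with `g(0,0) = π²`. -/
noncomputable def gFun (x y : ℝ) : ℝ :=
  if (x, y) = (0, 0) then π ^ 2
  else (1 - Real.exp (-π ^ 2 * (x ^ 2 + y ^ 2))) / (x ^ 2 + y ^ 2)

lemma gFun_zero_zero : gFun 0 0 = π ^ 2 := by simp [gFun]

lemma gFun_of_pos {x y : ℝ} (h : 0 < x ^ 2 + y ^ 2) :
    gFun x y = (1 - Real.exp (-π ^ 2 * (x ^ 2 + y ^ 2))) / (x ^ 2 + y ^ 2) := by
  refine if_neg fun h0 => ?_
  obtain ⟨rfl, rfl⟩ := Prod.mk.inj h0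
  simp at h

lemma gFun_neg_right (x y : ℝ) : gFun x (-y) = gFun x y := by simp [gFun]

lemma eq_zero_or_sq_add_sq_pos (x y : ℝ) : (x = 0 ∧ y = 0) ∨ 0 < x ^ 2 + y ^ 2 := by
  by_cases hx : x = 0
  · by_cases hy : y = 0
    · exact Or.inl ⟨hx, hy⟩
    · right; positivity
  · right; positivity

lemma abs_gFun_le (x y : ℝ) : |gFun x y| ≤ (π ^ 2 + 1) / (1 + y ^ 2) := by
  rcases eq_zero_or_sq_add_sq_pos x y with ⟨rfl, rfl⟩ | h
  · rw [gFun_zero_zero, abs_of_nonneg (by positivity)]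
    norm_num
  · rw [gFun_of_pos h]
    set t := x ^ 2 + y ^ 2 with ht
    have h1 := Real.add_one_le_exp (-π ^ 2 * t)
    have h2 : Real.exp (-π ^ 2 * t) ≤ 1 := Real.exp_le_one_iff.2 (by nlinarith [sq_nonneg π])
    have h3 := Real.exp_pos (-π ^ 2 * t)
    rw [abs_of_nonneg (div_nonneg (by linarith) h.le), div_le_div_iff₀ h (by positivity)]
    have h4 : y ^ 2 ≤ t := by nlinarith [sq_nonneg x]
    nlinarith [mul_le_mul_of_nonneg_left h4 (by linarith : 0 ≤ 1 - Real.exp (-π ^ 2 * t))]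

lemma hasDerivAt_gFun_right {x y : ℝ} (h : 0 < x ^ 2 + y ^ 2) :
    HasDerivAt (fun y' : ℝ => gFun x y')
      (-(2 * y * (1 - (1 + π ^ 2 * (x ^ 2 + y ^ 2)) * Real.exp (-π ^ 2 * (x ^ 2 + y ^ 2))) /
        (x ^ 2 + y ^ 2) ^ 2)) y := by
  have hq : HasDerivAt (fun y' : ℝ => x ^ 2 + y' ^ 2) (2 * y) y := by
    simpa using (hasDerivAt_pow 2 y).const_add (x ^ 2)
  have hd := ((hq.const_mul (-π ^ 2)).exp.const_sub 1).div hq h.ne'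
  have he : (fun y' : ℝ => gFun x y') =ᶠ[nhds y]
      fun y' => (1 - Real.exp (-π ^ 2 * (x ^ 2 + y' ^ 2))) / (x ^ 2 + y' ^ 2) :=
    (hq.continuousAt.eventually (lt_mem_nhds h)).mono fun _ hy' => gFun_of_pos hy'
  refine (hd.congr_of_eventuallyEq he).congr_deriv ?_
  field_simp
  ring

lemma one_sub_one_add_mul_exp_neg_mem {s : ℝ} (hs : 0 ≤ s) :
    0 ≤ 1 - (1 + s) * Real.exp (-s) ∧ 1 - (1 + s) * Real.exp (-s) ≤ 1 ∧
      1 - (1 + s) * Real.exp (-s) ≤ s ^ 2 := by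
  have h1 := Real.add_one_le_exp s
  have h2 := Real.add_one_le_exp (-s)
  have h3 := Real.exp_pos (-s)
  have h4 : Real.exp s * Real.exp (-s) = 1 := by rw [← Real.exp_add]; simp
  refine ⟨?_, ?_, ?_⟩ <;> nlinarith

lemma abs_deriv_gFun_right_le (x y : ℝ) :
    |deriv (fun y' : ℝ => gFun x y') y| ≤ (2 * π ^ 4 + 4) / (1 + |y| ^ 3) := by
  rcases eq_zero_or_sq_add_sq_pos x y with ⟨rfl, rfl⟩ | h
  · have h0 := deriv_comp_neg (fun y' : ℝ => gFun 0 y') 0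
    simp only [gFun_neg_right, neg_zero] at h0
    rw [show deriv (fun y' : ℝ => gFun 0 y') 0 = 0 by linarith, abs_zero]
    positivity
  · rw [(hasDerivAt_gFun_right h).deriv]
    set t := x ^ 2 + y ^ 2 with ht
    obtain ⟨h1, h2, h3⟩ := one_sub_one_add_mul_exp_neg_mem (s := π ^ 2 * t) (by positivity)
    rw [← neg_mul] at h1 h2 h3
    set N := 1 - (1 + π ^ 2 * t) * Real.exp (-π ^ 2 * t)
    rw [abs_neg, abs_div, abs_mul, abs_mul, abs_of_nonneg h1, abs_of_nonneg (sq_nonneg t), abs_two,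
      div_le_div_iff₀ (by positivity) (by positivity)]
    have hy : |y| ^ 4 ≤ t ^ 2 := by
      have : |y| ^ 4 = (y ^ 2) ^ 2 := by rw [← sq_abs y]; ring
      rw [this]
      exact pow_le_pow_left₀ (sq_nonneg y) (by nlinarith [sq_nonneg x]) 2
    have hy1 : |y| ≤ 1 + |y| ^ 4 := by
      nlinarith [sq_nonneg (|y| ^ 2 - 1 / 2), sq_nonneg (|y| - 1 / 2)]
    have h4 : N * |y| ^ 4 ≤ t ^ 2 :=
      (mul_le_of_le_one_left (by positivity) h2).trans hy
    have h5 : N * |y| ≤ N * (1 + |y| ^ 4) := mul_le_mul_of_nonneg_left hy1 h1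
    linarith [show 2 * |y| * N * (1 + |y| ^ 3) = 2 * (N * |y|) + 2 * (N * |y| ^ 4) by ring,
      show (π ^ 2 * t) ^ 2 = π ^ 4 * t ^ 2 by ring]

/-- There is a constant `c > 0` such that, uniformly in `x`,
`|g(x,y)| ≤ c/(1+y²)` and `|∂_y g(x,y)| ≤ c/(1+|y|³)`. -/
theorem gFun_decay_bounds :
    ∃ c : ℝ, 0 < c ∧ ∀ x y : ℝ,
      |gFun x y| ≤ c / (1 + y ^ 2) ∧
      |deriv (fun y' : ℝ => gFun x y') y| ≤ c / (1 + |y| ^ 3) := by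
  refine ⟨2 * π ^ 4 + 4, by positivity, fun x y =>
    ⟨(abs_gFun_le x y).trans ?_, abs_deriv_gFun_right_le x y⟩⟩
  refine div_le_div_of_nonneg_right ?_ (by positivity)
  nlinarith [sq_nonneg (π ^ 2 - 1)]
end

section
/- For u ∈ ℤ ∖ {0} define a(u) = (1/|u|) · Σ_{v∈ℤ, u+v even} u²/(u²+v²). Then for every b : ℤ → ℂ with b(0) = 0 and Σ_{k∈ℤ} |k|·|b(k)|² < ∞, one has Σ_{(k,m)∈ℤ²∖{(0,0)}} ((k+m)²·|b(k+m)|²/(k²+m²)) = Σ_{k∈ℤ∖{0}} 2·a(k)·|k|·|b(k)|², and both sides are finite. -/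
open Real

/-- The coefficient `a(u) = (1/|u|) · Σ_{v ∈ ℤ, u+v even} u²/(u²+v²)` of Lemma 4.6
(for `u ≠ 0`; the value at `u = 0` is irrelevant). -/
noncomputable def aCoeff (u : ℤ) : ℝ :=
  (1 / |(u : ℝ)|) * ∑' v : {v : ℤ // Even (u + v)}, (u : ℝ) ^ 2 / ((u : ℝ) ^ 2 + ((v : ℤ) : ℝ) ^ 2)

/-- If `0 < n` and `v = q * n + r` with `0 ≤ r < n`, then `n² / (n² + v²) ≤ 3 / (1 + q²)`. -/
lemma sq_div_sq_add_sq_le {n q r : ℝ} (hn : 0 < n) (hr : 0 ≤ r) (hrn : r ≤ n) :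
    n ^ 2 / (n ^ 2 + (q * n + r) ^ 2) ≤ 3 * (1 / (1 + q ^ 2)) := by
  rw [mul_one_div, div_le_div_iff₀ (by positivity) (by positivity)]
  have hrr : r ^ 2 ≤ n ^ 2 := by gcongr
  nlinarith [sq_nonneg (q * n + 2 * r)]

lemma summable_one_div_one_add_int_sq : Summable fun q : ℤ => 1 / (1 + (q : ℝ) ^ 2) := by
  have h : Summable fun q : ℤ => 1 / (q : ℝ) ^ 2 :=
    Real.summable_one_div_int_pow.mpr one_lt_two
  refine h.of_norm_bounded_eventually ?_
  filter_upwards [(Set.finite_singleton (0 : ℤ)).compl_mem_cofinite] with q hq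
  have hq' : (q : ℝ) ≠ 0 := by exact_mod_cast hq
  rw [Real.norm_of_nonneg (by positivity)]
  gcongr
  linarith

/-- For `n > 0`, the sum over `v ∈ ℤ` of `n² / (n² + v²)` grows at most linearly in `n`. -/
lemma summable_sq_div_sq_add_int_sq_and_tsum_le (n : ℕ) [NeZero n] :
    Summable (fun v : ℤ => (n : ℝ) ^ 2 / ((n : ℝ) ^ 2 + (v : ℝ) ^ 2)) ∧
      ∑' v : ℤ, (n : ℝ) ^ 2 / ((n : ℝ) ^ 2 + (v : ℝ) ^ 2) ≤
        n * (3 * ∑' q : ℤ, 1 / (1 + (q : ℝ) ^ 2)) := by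
  have hn : (0 : ℝ) < n := by exact_mod_cast Nat.pos_of_ne_zero (NeZero.ne n)
  set f : ℤ → ℝ := fun v => (n : ℝ) ^ 2 / ((n : ℝ) ^ 2 + (v : ℝ) ^ 2) with hf
  let e : Fin n × ℤ ≃ ℤ := (Equiv.prodComm _ _).trans (Int.divModEquiv n).symm
  have hs : Summable fun q : ℤ => 3 * (1 / (1 + (q : ℝ) ^ 2)) :=
    summable_one_div_one_add_int_sq.mul_left 3
  have hle : ∀ (r : Fin n) (q : ℤ), f (e (r, q)) ≤ 3 * (1 / (1 + (q : ℝ) ^ 2)) := by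
    intro r q
    have he : ((e (r, q) : ℤ) : ℝ) = q * n + (r : ℕ) := by simp [e, Int.divModEquiv]
    simp only [hf, he]
    exact sq_div_sq_add_sq_le hn (by positivity) (by exact_mod_cast r.2.le)
  have hnn : ∀ v, 0 ≤ f v := fun v => by simp only [hf]; positivity
  have hfib : ∀ r : Fin n, Summable fun q : ℤ => f (e (r, q)) := fun r =>
    hs.of_nonneg_of_le (fun q => hnn _) (hle r)
  have hsum : Summable (f ∘ e) :=
    (summable_prod_of_nonneg (fun p => hnn _)).mpr ⟨hfib, (hasSum_fintype _).summable⟩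
  refine ⟨e.summable_iff.mp hsum, ?_⟩
  rw [← e.tsum_eq f, Summable.tsum_prod (f := fun c => f (e c)) hsum, tsum_fintype, ← tsum_mul_left]
  calc ∑ r : Fin n, ∑' q : ℤ, f (e (r, q))
      ≤ ∑ _r : Fin n, ∑' q : ℤ, 3 * (1 / (1 + (q : ℝ) ^ 2)) :=
        Finset.sum_le_sum fun r _ => (hfib r).tsum_le_tsum (hle r) hs
    _ = n * ∑' q : ℤ, 3 * (1 / (1 + (q : ℝ) ^ 2)) := by simp

/-- For `u ≠ 0`, the series defining `aCoeff u` converges, with a bound linear in `|u|`. -/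
lemma summable_even_and_tsum_le {u : ℤ} (hu : u ≠ 0) :
    Summable (fun v : {v : ℤ // Even (u + v)} =>
      (u : ℝ) ^ 2 / ((u : ℝ) ^ 2 + ((v : ℤ) : ℝ) ^ 2)) ∧
      ∑' v : {v : ℤ // Even (u + v)}, (u : ℝ) ^ 2 / ((u : ℝ) ^ 2 + ((v : ℤ) : ℝ) ^ 2) ≤
        |(u : ℝ)| * (3 * ∑' q : ℤ, 1 / (1 + (q : ℝ) ^ 2)) := by
  have : NeZero u.natAbs := ⟨Int.natAbs_ne_zero.mpr hu⟩
  obtain ⟨hs, hle⟩ := summable_sq_div_sq_add_int_sq_and_tsum_le u.natAbs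
  have habs : ((u.natAbs : ℕ) : ℝ) = |(u : ℝ)| := by simp [Nat.cast_natAbs]
  simp only [habs, sq_abs] at hs hle
  exact ⟨hs.subtype {v | Even (u + v)},
    (hs.tsum_subtype_le _ {v | Even (u + v)} fun v => by positivity).trans hle⟩

/-- The change of variables `u = k + m`, `v = k - m` from `ℤ²` onto the pairs of equal parity. -/
def sumDiffEquiv : ℤ × ℤ ≃ Σ u : ℤ, {v : ℤ // Even (u + v)} where
  toFun p := ⟨p.1 + p.2, p.1 - p.2, p.1, by ring⟩
  invFun s := ((s.1 + s.2) / 2, (s.1 - s.2) / 2)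
  left_inv p := by ext <;> simp <;> omega
  right_inv := by
    rintro ⟨u, v, w, hw⟩
    obtain rfl : v = w + w - u := by omega
    have h₁ : (u + (w + w - u)) / 2 = w := by omega
    have h₂ : (u - (w + w - u)) / 2 = u - w := by omega
    refine Sigma.subtype_ext ?_ ?_ <;> simp only [h₁, h₂] <;> ring

/-- Lemma 4.6 identity: for every `b : ℤ → ℂ` with `b(0) = 0` and `Σ |k||b(k)|² < ∞`,
`Σ_{(k,m)≠(0,0)} (k+m)²|b(k+m)|²/(k²+m²) = Σ_{k≠0} 2·a(k)·|k|·|b(k)|²`,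
and both sides are finite. -/
theorem weighted_energy_change_of_variables (b : ℤ → ℂ) (hb0 : b 0 = 0)
    (hb : Summable fun k : ℤ => |(k : ℝ)| * ‖b k‖ ^ 2) :
    Summable (fun p : {p : ℤ × ℤ // p ≠ 0} =>
      ((p.1.1 + p.1.2 : ℤ) : ℝ) ^ 2 * ‖b (p.1.1 + p.1.2)‖ ^ 2
        / ((p.1.1 : ℝ) ^ 2 + (p.1.2 : ℝ) ^ 2)) ∧
    Summable (fun k : {k : ℤ // k ≠ 0} =>
      2 * aCoeff k * |((k : ℤ) : ℝ)| * ‖b k‖ ^ 2) ∧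
    (∑' p : {p : ℤ × ℤ // p ≠ 0},
      ((p.1.1 + p.1.2 : ℤ) : ℝ) ^ 2 * ‖b (p.1.1 + p.1.2)‖ ^ 2
        / ((p.1.1 : ℝ) ^ 2 + (p.1.2 : ℝ) ^ 2))
      = ∑' k : {k : ℤ // k ≠ 0}, 2 * aCoeff k * |((k : ℤ) : ℝ)| * ‖b k‖ ^ 2 := by
  have hsub : ∀ {α : Type} (f : α → ℝ) (a : α), f a = 0 →
      Function.support f ⊆ {x | x ≠ a} := fun f a h x hx hxa => hx (hxa ▸ h)
  set F : ℤ × ℤ → ℝ := fun p => ((p.1 + p.2 : ℤ) : ℝ) ^ 2 * ‖b (p.1 + p.2)‖ ^ 2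
    / ((p.1 : ℝ) ^ 2 + (p.2 : ℝ) ^ 2) with hF
  set A : ℤ → ℝ := fun k => 2 * aCoeff k * |(k : ℝ)| * ‖b k‖ ^ 2 with hA
  let G : (Σ u : ℤ, {v : ℤ // Even (u + v)}) → ℝ := fun s =>
    (s.1 : ℝ) ^ 2 / ((s.1 : ℝ) ^ 2 + ((s.2 : ℤ) : ℝ) ^ 2) * (2 * ‖b s.1‖ ^ 2)
  have hFG : F = G ∘ sumDiffEquiv := by
    funext p
    have h : ((p.1 + p.2 : ℤ) : ℝ) ^ 2 + ((p.1 - p.2 : ℤ) : ℝ) ^ 2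
        = 2 * ((p.1 : ℝ) ^ 2 + (p.2 : ℝ) ^ 2) := by push_cast; ring
    simp only [hF, G, Function.comp_apply, sumDiffEquiv, Equiv.coe_fn_mk, h]
    rw [div_mul_eq_mul_div, mul_left_comm, mul_div_mul_left _ _ two_ne_zero]
  have hGA : ∀ u : ℤ, ∑' v, G ⟨u, v⟩ = A u := by
    intro u
    rcases eq_or_ne u 0 with rfl | hu
    · simp [G, hA, hb0]
    · have hu' : |(u : ℝ)| ≠ 0 := by simpa using hu
      simp only [G, hA, aCoeff, tsum_mul_right]
      field_simp
  have hG0 : ∀ s, 0 ≤ G s := fun s => by simp only [G]; positivity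
  have hGfib : ∀ u : ℤ, Summable fun v => G ⟨u, v⟩ := by
    intro u
    rcases eq_or_ne u 0 with rfl | hu
    · simp [G, hb0, summable_zero]
    · exact (summable_even_and_tsum_le hu).1.mul_right (2 * ‖b u‖ ^ 2)
  have hAs : Summable A := by
    refine (hb.mul_left (2 * (3 * ∑' q : ℤ, 1 / (1 + (q : ℝ) ^ 2)))).of_nonneg_of_le
      (fun u => hGA u ▸ tsum_nonneg fun v => hG0 _) fun u => ?_
    rcases eq_or_ne u 0 with rfl | hu
    · simp [hA]
    · rw [← hGA u]
      simp only [G, tsum_mul_right]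
      calc _ ≤ |(u : ℝ)| * (3 * ∑' q : ℤ, 1 / (1 + (q : ℝ) ^ 2)) * (2 * ‖b u‖ ^ 2) := by
            gcongr
            exact (summable_even_and_tsum_le hu).2
        _ = _ := by ring
  have hGs : Summable G := (summable_sigma_of_nonneg hG0).mpr ⟨hGfib, by simpa only [hGA] using hAs⟩
  have hFs : Summable F := hFG ▸ sumDiffEquiv.summable_iff.mpr hGs
  refine ⟨hFs.subtype {p | p ≠ 0}, hAs.subtype {k | k ≠ 0}, ?_⟩
  calc ∑' p : {p : ℤ × ℤ // p ≠ 0}, F p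
      = ∑' p, F p := tsum_subtype_eq_of_support_subset (hsub F 0 (by simp [hF]))
    _ = ∑' s, G s := hFG ▸ sumDiffEquiv.tsum_eq G
    _ = ∑' u, A u := by rw [hGs.tsum_sigma]; simp only [hGA]
    _ = ∑' k : {k : ℤ // k ≠ 0}, A k :=
        (tsum_subtype_eq_of_support_subset (hsub A 0 (by simp [hA]))).symm
end
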